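/- Let F : T → T' be a tensor triangulated functor (a triangulated symmetric monoidal functor) between rigidly compactly generated tensor triangulated categories, which preserves small coproducts, is conservative (reflects isomorphisms), and satisfies F(T^c) ⊆ T'^c. Then the induced map on thick tensor ideals of compact objects is injective: if C and C' are thick tensor ideals of T^c such that the smallest thick tensor ideal of T'^c containing F(C) equals the smallest thick tensor ideal of T'^c containing F(C'), then C = C'. -/

import Mathlib

open CategoryTheory Category Limits Pretriangulated ZeroObject MonoidalCategory

universe v u u₂

namespace Paper

variable {C : Type u} [Category.{v} C] [Preadditive C] [HasZeroObject C] [HasShift C ℤ]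
  [∀ n : ℤ, (shiftFunctor C n).Additive] [Pretriangulated C] [IsTriangulated C]
  [HasCoproducts.{v} C]

variable [MonoidalCategory C] [SymmetricCategory C]
  [∀ X : C, (tensorLeft X).CommShift ℤ]
  [∀ X : C, (tensorRight X).CommShift ℤ]
  [∀ X : C, (tensorLeft X).IsTriangulated]
  [∀ X : C, (tensorRight X).IsTriangulated]
  [∀ (X : C) (ι : Type v), PreservesColimitsOfShape (Discrete ι) (tensorLeft X)]
  [∀ (X : C) (ι : Type v), PreservesColimitsOfShape (Discrete ι) (tensorRight X)]

variable {D : Type u₂} [Category.{v} D] [Preadditive D] [HasZeroObject D] [HasShift D ℤ]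
  [∀ n : ℤ, (shiftFunctor D n).Additive] [Pretriangulated D] [IsTriangulated D]
  [HasCoproducts.{v} D]

variable [MonoidalCategory D] [SymmetricCategory D]
  [∀ X : D, (tensorLeft X).CommShift ℤ]
  [∀ X : D, (tensorRight X).CommShift ℤ]
  [∀ X : D, (tensorLeft X).IsTriangulated]
  [∀ X : D, (tensorRight X).IsTriangulated]
  [∀ (X : D) (ι : Type v), PreservesColimitsOfShape (Discrete ι) (tensorLeft X)]
  [∀ (X : D) (ι : Type v), PreservesColimitsOfShape (Discrete ι) (tensorRight X)]

/-- A (full, replete) triangulated subcategory, encoded as its set of objects: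
it contains a zero object, is closed under isomorphisms, and satisfies two-out-of-three
for distinguished triangles. -/
structure IsTriangulatedSub {E : Type*} [Category E] [Preadditive E] [HasZeroObject E]
    [HasShift E ℤ] [∀ n : ℤ, (shiftFunctor E n).Additive] [Pretriangulated E]
    (S : Set E) : Prop where
  zero_mem : (0 : E) ∈ S
  iso_closed : ∀ ⦃X Y : E⦄, (X ≅ Y) → X ∈ S → Y ∈ S
  two_of_three₃ : ∀ T, (T ∈ distTriang E) → T.obj₁ ∈ S → T.obj₂ ∈ S → T.obj₃ ∈ S
  two_of_three₂ : ∀ T, (T ∈ distTriang E) → T.obj₁ ∈ S → T.obj₃ ∈ S → T.obj₂ ∈ S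
  two_of_three₁ : ∀ T, (T ∈ distTriang E) → T.obj₂ ∈ S → T.obj₃ ∈ S → T.obj₁ ∈ S

/-- A localizing subcategory: a triangulated subcategory closed under small coproducts. -/
def IsLocalizing (S : Set C) : Prop :=
  IsTriangulatedSub S ∧ ∀ {ι : Type v} (x : ι → C), (∀ i, x i ∈ S) → (∐ x) ∈ S

/-- `⟨A⟩`: the smallest localizing subcategory containing the class `A`. -/
def localizingGen (A : Set C) : Set C :=
  ⋂₀ {S : Set C | IsLocalizing S ∧ A ⊆ S}

/-- The canonical comparison map `⊕ᵢ Hom(t, x i) →+ Hom(t, ∐ x)` sending the `i`-th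
component `g` to `g ≫ Sigma.ι x i`. -/
noncomputable def coproductComparison (t : C) {ι : Type v} (x : ι → C) :
    (DirectSum ι fun i => (t ⟶ x i)) →+ (t ⟶ ∐ x) :=
  letI : DecidableEq ι := Classical.decEq ι
  DirectSum.toAddMonoid fun i =>
    AddMonoidHom.mk' (fun g => g ≫ Sigma.ι x i) fun _ _ => Preadditive.add_comp _ _ _ _ _ _

/-- An object `t` is compact if for every small family `x` the canonical map
`⊕ᵢ Hom(t, x i) → Hom(t, ∐ x)` is bijective. -/
def IsCompactObj (t : C) : Prop :=
  ∀ {ι : Type v} (x : ι → C), Function.Bijective (coproductComparison t x)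

variable (C) in
/-- The class `T^c` of compact objects. -/
def compacts : Set C := {t : C | IsCompactObj t}

variable (C) in
/-- `T` is compactly generated: there is a set of compact objects `G` such that any object
receiving no nonzero maps from shifts of objects of `G` is zero. -/
def IsCompactlyGenerated : Prop :=
  ∃ G : Set C, (∀ g ∈ G, IsCompactObj g) ∧
    ∀ x : C, (∀ g ∈ G, ∀ n : ℤ, ∀ f : (g⟦n⟧ ⟶ x), f = 0) → IsZero x

/-- A thick subcategory: a triangulated subcategory closed under direct summands. -/
def IsThick (S : Set C) : Prop :=
  IsTriangulatedSub S ∧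
    ∀ ⦃X Y : C⦄, (∃ (i : Y ⟶ X) (r : X ⟶ Y), i ≫ r = 𝟙 Y) → X ∈ S → Y ∈ S

/-- An object is rigid (strongly dualizable) if it admits a dual, i.e. there is an
exact pairing with some object. -/
def IsRigid (d : C) : Prop := ∃ e : C, Nonempty (ExactPairing d e)

variable (C) in
/-- A thick tensor ideal of the subcategory `T^c` of compact objects. -/
def IsThickTensorIdealOfCompacts (A : Set C) : Prop :=
  A ⊆ compacts C ∧ IsThick A ∧ ∀ s ∈ A, ∀ t ∈ compacts C, s ⊗ t ∈ A

variable (C) in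
/-- The smallest thick tensor ideal of `T^c` containing the class `A`. -/
def thickTensorIdealGenOfCompacts (A : Set C) : Set C :=
  ⋂₀ {S : Set C | IsThickTensorIdealOfCompacts C S ∧ A ⊆ S}

lemma isZero_of_isZero_map {E E' : Type*} [Category.{v} E] [Category.{v} E']
    [HasZeroMorphisms E] [HasZeroObject E] [HasZeroMorphisms E'] [HasZeroObject E']
    (F : E ⥤ E') [F.PreservesZeroMorphisms] [F.ReflectsIsomorphisms]
    {X : E} (h : IsZero (F.obj X)) : IsZero X := by
  have : IsIso (F.map (0 : X ⟶ 0)) :=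
    isIso_of_source_target_iso_zero _ h.isoZero (F.map_isZero (isZero_zero E)).isoZero
  have : IsIso (0 : X ⟶ 0) := isIso_of_reflects_iso _ F
  exact (isZero_zero E).of_iso (asIso (0 : X ⟶ 0))

section Coproducts

variable {E : Type*} [Category.{v} E] [Preadditive E] [HasCoproducts.{v} E]
variable {E' : Type*} [Category.{v} E'] [Preadditive E'] [HasCoproducts.{v} E']
variable {ι : Type v}

open Classical in
/-- The idempotent endomorphism of `∐ x` projecting onto the summands indexed by `s`. -/
noncomputable def finsetProj (x : ι → E) (s : Finset ι) : ∐ x ⟶ ∐ x :=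
  Sigma.desc fun i => if i ∈ s then Sigma.ι x i else 0

lemma ι_finsetProj_of_mem (x : ι → E) {s : Finset ι} {i : ι} (hi : i ∈ s) :
    Sigma.ι x i ≫ finsetProj x s = Sigma.ι x i := by
  simp [finsetProj, hi]

lemma ι_finsetProj_of_notMem (x : ι → E) {s : Finset ι} {i : ι} (hi : i ∉ s) :
    Sigma.ι x i ≫ finsetProj x s = 0 := by
  simp [finsetProj, hi]

lemma finsetProj_comp_of_subset (x : ι → E) {s t : Finset ι} (hst : s ⊆ t) :
    finsetProj x s ≫ finsetProj x t = finsetProj x s := by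
  refine Sigma.hom_ext _ _ fun i => ?_
  by_cases hi : i ∈ s
  · rw [← assoc, ι_finsetProj_of_mem x hi, ι_finsetProj_of_mem x (hst hi)]
  · rw [← assoc, ι_finsetProj_of_notMem x hi, zero_comp]

lemma comp_finsetProj_of_subset {t : E} {x : ι → E} {f : t ⟶ ∐ x} {s s' : Finset ι}
    (hs : s ⊆ s') (hf : f ≫ finsetProj x s = f) : f ≫ finsetProj x s' = f := by
  rw [← hf, assoc, finsetProj_comp_of_subset x hs]

lemma id_sub_finsetProj_comp [DecidableEq ι] (x : ι → E) (s t : Finset ι) :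
    (𝟙 _ - finsetProj x s) ≫ (𝟙 _ - finsetProj x t) = 𝟙 _ - finsetProj x (s ∪ t) := by
  refine Sigma.hom_ext _ _ fun i => ?_
  by_cases hs : i ∈ s <;> by_cases ht : i ∈ t <;>
    simp only [Preadditive.comp_sub, Preadditive.sub_comp, comp_id, id_comp, ← assoc]
  · simp [ι_finsetProj_of_mem x hs, ι_finsetProj_of_mem x ht,
      ι_finsetProj_of_mem x (Finset.mem_union_left t hs)]
  · simp [ι_finsetProj_of_mem x hs, ι_finsetProj_of_notMem x ht,
      ι_finsetProj_of_mem x (Finset.mem_union_left t hs)]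
  · simp [ι_finsetProj_of_notMem x hs, ι_finsetProj_of_mem x ht,
      ι_finsetProj_of_mem x (Finset.mem_union_right s ht)]
  · simp [ι_finsetProj_of_notMem x hs, ι_finsetProj_of_notMem x ht,
      ι_finsetProj_of_notMem x (show i ∉ s ∪ t by simp [hs, ht])]

lemma finsetProj_comp_π_of_notMem [DecidableEq ι] (x : ι → E) {s : Finset ι} {i : ι}
    (hi : i ∉ s) : finsetProj x s ≫ Sigma.π x i = 0 := by
  refine Sigma.hom_ext _ _ fun j => ?_
  by_cases hj : j ∈ s
  · rw [← assoc, ι_finsetProj_of_mem x hj, comp_zero, Sigma.ι_π_of_ne]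
    rintro rfl
    exact hi hj
  · rw [← assoc, ι_finsetProj_of_notMem x hj, zero_comp, comp_zero]

lemma finsetProj_eq_sum [DecidableEq ι] (x : ι → E) (s : Finset ι) :
    finsetProj x s = ∑ i ∈ s, Sigma.π x i ≫ Sigma.ι x i := by
  refine Sigma.hom_ext _ _ fun j => ?_
  rw [Preadditive.comp_sum]
  by_cases hj : j ∈ s
  · rw [ι_finsetProj_of_mem x hj, Finset.sum_eq_single_of_mem j hj]
    · rw [← assoc, Sigma.ι_π_eq_id, id_comp]
    · intro i _ hij
      rw [← assoc, Sigma.ι_π_of_ne _ hij.symm, zero_comp]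
  · rw [ι_finsetProj_of_notMem x hj, Finset.sum_eq_zero]
    intro i hi
    rw [← assoc, Sigma.ι_π_of_ne _ (by rintro rfl; exact hj hi), zero_comp]

lemma coproductComparison_of (t : E) (x : ι → E) (i : ι) (g : t ⟶ x i) :
    letI : DecidableEq ι := Classical.decEq ι
    coproductComparison t x (DirectSum.of (fun i => (t ⟶ x i)) i g) = g ≫ Sigma.ι x i := by
  simp [coproductComparison]

lemma coproductComparison_comp_π (t : E) (x : ι → E) (d : DirectSum ι fun i => (t ⟶ x i))
    (i : ι) :
    letI : DecidableEq ι := Classical.decEq ι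
    coproductComparison t x d ≫ Sigma.π x i = d i := by
  let : DecidableEq ι := Classical.decEq ι
  induction d using DirectSum.induction_on with
  | zero => simp
  | of j g =>
    rw [coproductComparison_of, assoc]
    by_cases h : j = i
    · subst h
      rw [Sigma.ι_π_eq_id, comp_id, DirectSum.of_eq_same]
    · rw [Sigma.ι_π_of_ne _ h, comp_zero, DirectSum.of_eq_of_ne _ _ _ (Ne.symm h)]
  | add d d' hd hd' => rw [map_add, Preadditive.add_comp, hd, hd', DirectSum.add_apply]

/-- An object is compact iff every map to a coproduct factors through a finite subcoproduct. -/
lemma isCompactObj_iff (t : E) :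
    IsCompactObj t ↔
      ∀ {ι : Type v} (x : ι → E) (f : t ⟶ ∐ x), ∃ s : Finset ι, f ≫ finsetProj x s = f := by
  constructor
  · intro ht ι x f
    let : DecidableEq ι := Classical.decEq ι
    obtain ⟨d, rfl⟩ := (ht x).2 f
    induction d using DirectSum.induction_on with
    | zero => exact ⟨∅, by simp⟩
    | of i g =>
      refine ⟨{i}, ?_⟩
      rw [coproductComparison_of, assoc, ι_finsetProj_of_mem x (Finset.mem_singleton_self i)]
    | add d d' hd hd' =>
      obtain ⟨s, hs⟩ := hd
      obtain ⟨s', hs'⟩ := hd'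
      refine ⟨s ∪ s', ?_⟩
      rw [map_add, Preadditive.add_comp,
        comp_finsetProj_of_subset Finset.subset_union_left hs,
        comp_finsetProj_of_subset Finset.subset_union_right hs']
  · intro ht ι x
    let : DecidableEq ι := Classical.decEq ι
    constructor
    · intro d d' h
      refine DFinsupp.ext fun i => ?_
      exact (coproductComparison_comp_π t x d i).symm.trans
        ((congrArg (· ≫ Sigma.π x i) h).trans (coproductComparison_comp_π t x d' i))
    · intro f
      obtain ⟨s, hs⟩ := ht x f
      refine ⟨∑ i ∈ s, DirectSum.of (fun i => (t ⟶ x i)) i (f ≫ Sigma.π x i), ?_⟩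
      rw [map_sum]
      conv_rhs => rw [← hs, finsetProj_eq_sum, Preadditive.comp_sum]
      refine Finset.sum_congr rfl fun i _ => ?_
      rw [coproductComparison_of, assoc]

lemma IsCompactObj.of_retract {X Y : E} (hX : IsCompactObj X) (i : Y ⟶ X) (r : X ⟶ Y)
    (hir : i ≫ r = 𝟙 Y) : IsCompactObj Y := by
  rw [isCompactObj_iff] at hX ⊢
  intro ι x f
  obtain ⟨s, hs⟩ := hX x (r ≫ f)
  refine ⟨s, ?_⟩
  rw [assoc] at hs
  simpa only [← assoc, hir, id_comp] using congrArg (i ≫ ·) hs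

lemma IsCompactObj.of_iso {X Y : E} (hX : IsCompactObj X) (e : X ≅ Y) : IsCompactObj Y :=
  hX.of_retract e.inv e.hom e.inv_hom_id

lemma IsCompactObj.exists_comp_map_finsetProj {t : E'} (ht : IsCompactObj t) (R : E ⥤ E')
    [R.Additive] (x : ι → E) [PreservesColimitsOfShape (Discrete ι) R]
    (f : t ⟶ R.obj (∐ x)) : ∃ s : Finset ι, f ≫ R.map (finsetProj x s) = f := by
  obtain ⟨s, hs⟩ := (isCompactObj_iff t).1 ht (fun i => R.obj (x i))
    (f ≫ inv (sigmaComparison R x))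
  refine ⟨s, ?_⟩
  have key : finsetProj (fun i => R.obj (x i)) s ≫ sigmaComparison R x =
      sigmaComparison R x ≫ R.map (finsetProj x s) := by
    refine Sigma.hom_ext _ _ fun i => ?_
    rw [← assoc, ← assoc, ι_comp_sigmaComparison, ← R.map_comp]
    by_cases hi : i ∈ s
    · rw [ι_finsetProj_of_mem _ hi, ι_finsetProj_of_mem _ hi, ι_comp_sigmaComparison]
    · rw [ι_finsetProj_of_notMem _ hi, ι_finsetProj_of_notMem _ hi, zero_comp, R.map_zero]
  rw [assoc] at hs
  have h := congrArg (· ≫ sigmaComparison R x) hs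
  simpa only [assoc, key, IsIso.inv_hom_id, IsIso.inv_hom_id_assoc, comp_id] using h

lemma isCompactObj_of_isZero {X : E} (hX : IsZero X) :
    IsCompactObj X := by
  rw [isCompactObj_iff]
  exact fun x f => ⟨∅, hX.eq_of_src _ _⟩

lemma IsCompactObj.map_leftAdjoint {L : E' ⥤ E} {R : E ⥤ E'} (adj : L ⊣ R) [R.Additive]
    [∀ ι : Type v, PreservesColimitsOfShape (Discrete ι) R] {t : E'} (ht : IsCompactObj t) :
    IsCompactObj (L.obj t) := by
  rw [isCompactObj_iff]
  intro ι x f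
  obtain ⟨s, hs⟩ := ht.exists_comp_map_finsetProj R x (adj.homEquiv _ _ f)
  refine ⟨s, (adj.homEquiv _ _).injective ?_⟩
  rw [adj.homEquiv_naturality_right, hs]

end Coproducts

section Telescope

variable {E : Type*} [Category.{v} E] [HasCoproducts.{v} E]
variable (X : ℕ → E) (τ : ∀ n, X n ⟶ X (n + 1))

/-- The family `X`, reindexed so that `E` is known to have its coproduct. -/
abbrev telescopeFamily : ULift.{v} ℕ → E := fun n => X n.down

/-- The inclusion of `X n` in the coproduct of the family. -/
noncomputable def telescopeι (n : ℕ) : X n ⟶ ∐ telescopeFamily X :=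
  Sigma.ι (telescopeFamily X) ⟨n⟩

/-- The endomorphism of `∐ X` induced by the transition maps `τ`. -/
noncomputable def telescopeShift : ∐ telescopeFamily X ⟶ ∐ telescopeFamily X :=
  Sigma.desc fun n => τ n.down ≫ telescopeι X (n.down + 1)

/-- The composite of the first `n` transition maps. -/
def telescopeMap : ∀ n, X 0 ⟶ X n
  | 0 => 𝟙 _
  | n + 1 => telescopeMap n ≫ τ n

variable {X} in
lemma telescope_hom_ext {Y : E} {f g : ∐ telescopeFamily X ⟶ Y}
    (h : ∀ n, telescopeι X n ≫ f = telescopeι X n ≫ g) : f = g :=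
  Sigma.hom_ext _ _ fun n => h n.down

lemma telescopeι_shift (n : ℕ) :
    telescopeι X n ≫ telescopeShift X τ = τ n ≫ telescopeι X (n + 1) := by
  simp [telescopeι, telescopeShift]

variable [Preadditive E]
variable {E' : Type*} [Category.{v} E'] [Preadditive E'] [HasCoproducts.{v} E']

/-- The projection of the coproduct of the family onto `X n`. -/
noncomputable def telescopeπ (n : ℕ) : ∐ telescopeFamily X ⟶ X n :=
  Sigma.π (telescopeFamily X) ⟨n⟩

@[simp]
lemma telescopeι_π_self (n : ℕ) : telescopeι X n ≫ telescopeπ X n = 𝟙 _ :=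
  Sigma.ι_π_eq_id (telescopeFamily X) ⟨n⟩

lemma telescopeι_π_of_ne {m n : ℕ} (h : m ≠ n) : telescopeι X m ≫ telescopeπ X n = 0 :=
  Sigma.ι_π_of_ne (telescopeFamily X) (fun h' => h (congrArg ULift.down h'))

lemma id_sub_telescopeShift_comp_π_zero :
    (𝟙 _ - telescopeShift X τ) ≫ telescopeπ X 0 = telescopeπ X 0 := by
  refine telescope_hom_ext fun n => ?_
  rw [Preadditive.sub_comp, id_comp, Preadditive.comp_sub, ← assoc _ (telescopeShift X τ),
    telescopeι_shift, assoc, telescopeι_π_of_ne X (Nat.succ_ne_zero n), comp_zero, sub_zero]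

lemma id_sub_telescopeShift_comp_π_succ (n : ℕ) :
    (𝟙 _ - telescopeShift X τ) ≫ telescopeπ X (n + 1) =
      telescopeπ X (n + 1) - telescopeπ X n ≫ τ n := by
  refine telescope_hom_ext fun m => ?_
  rw [Preadditive.sub_comp, id_comp, Preadditive.comp_sub, ← assoc _ (telescopeShift X τ),
    telescopeι_shift, assoc, Preadditive.comp_sub, ← assoc _ (telescopeπ X n)]
  by_cases h : m = n
  · subst h
    simp
  · rw [telescopeι_π_of_ne X h, telescopeι_π_of_ne X (show m + 1 ≠ n + 1 by omega), comp_zero,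
      zero_comp]

lemma map_id_sub_telescopeShift (H : E ⥤ E') [H.Additive]
    [PreservesColimitsOfShape (Discrete (ULift.{v} ℕ)) H] (hτ : ∀ n, H.map (τ n) = 0) :
    H.map (𝟙 _ - telescopeShift X τ) = 𝟙 _ := by
  have : H.map (telescopeShift X τ) = 0 := by
    rw [← cancel_epi (sigmaComparison H (telescopeFamily X))]
    refine Sigma.hom_ext _ _ fun n => ?_
    rw [← assoc, ι_comp_sigmaComparison, ← H.map_comp]
    have := telescopeι_shift X τ n.down
    rw [telescopeι] at this
    erw [this]
    rw [H.map_comp, hτ]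
    simp
  rw [H.map_sub, this, sub_zero, H.map_id]

lemma exists_comp_map_telescopeMap_eq_zero (H : E ⥤ E') [H.Additive]
    [PreservesColimitsOfShape (Discrete (ULift.{v} ℕ)) H] {t : E'} (ht : IsCompactObj t)
    (hiso : IsIso (H.map (𝟙 _ - telescopeShift X τ))) (u : t ⟶ H.obj (X 0)) :
    ∃ n, u ≫ H.map (telescopeMap X τ n) = 0 := by
  obtain ⟨z, hz⟩ : ∃ z, z ≫ H.map (𝟙 _ - telescopeShift X τ) = u ≫ H.map (telescopeι X 0) :=
    ⟨u ≫ H.map (telescopeι X 0) ≫ inv (H.map (𝟙 _ - telescopeShift X τ)), by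
      simp only [assoc, IsIso.inv_hom_id, comp_id]⟩
  have hcomp : ∀ n, z ≫ H.map (telescopeπ X n) = u ≫ H.map (telescopeMap X τ n) := by
    intro n
    induction n with
    | zero =>
      rw [← id_sub_telescopeShift_comp_π_zero X τ, H.map_comp, ← assoc, hz, assoc,
        ← H.map_comp, telescopeι_π_self, telescopeMap]
    | succ n ih =>
      have h : z ≫ H.map ((𝟙 _ - telescopeShift X τ) ≫ telescopeπ X (n + 1)) = 0 := by
        rw [H.map_comp, ← assoc, hz, assoc, ← H.map_comp,
          telescopeι_π_of_ne X (Nat.succ_ne_zero n).symm, H.map_zero, comp_zero]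
      rw [id_sub_telescopeShift_comp_π_succ, H.map_sub, Preadditive.comp_sub, sub_eq_zero,
        H.map_comp, ← assoc, ih, assoc, ← H.map_comp] at h
      exact h
  obtain ⟨s, hs⟩ := ht.exists_comp_map_finsetProj H (telescopeFamily X) z
  obtain ⟨j, hj⟩ := Infinite.exists_notMem_finset s
  refine ⟨j.down, ?_⟩
  rw [← hcomp, ← hs, assoc, ← H.map_comp, telescopeπ, finsetProj_comp_π_of_notMem _ hj,
    H.map_zero, comp_zero]

end Telescope

section TriangulatedSub

variable {E : Type*} [Category.{v} E] [Preadditive E] [HasZeroObject E] [HasShift E ℤ]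
  [∀ n : ℤ, (shiftFunctor E n).Additive] [Pretriangulated E]

lemma IsTriangulatedSub.of_shift_of_ext {S : Set E} (zero : (0 : E) ∈ S)
    (iso : ∀ ⦃X Y : E⦄, (X ≅ Y) → X ∈ S → Y ∈ S)
    (shift : ∀ (X : E) (n : ℤ), X ∈ S → X⟦n⟧ ∈ S)
    (ext : ∀ T, (T ∈ distTriang E) → T.obj₁ ∈ S → T.obj₃ ∈ S → T.obj₂ ∈ S) :
    IsTriangulatedSub S where
  zero_mem := zero
  iso_closed := iso
  two_of_three₃ T hT h₁ h₂ := ext _ (rot_of_distTriang T hT) h₂ (shift _ 1 h₁)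
  two_of_three₂ := ext
  two_of_three₁ T hT h₂ h₃ := ext _ (inv_rot_of_distTriang T hT) (shift _ (-1) h₃) h₂

variable {S : Set E}

lemma IsTriangulatedSub.mem_of_isZero (hS : IsTriangulatedSub S) {X : E} (hX : IsZero X) :
    X ∈ S :=
  hS.iso_closed ((isZero_zero E).iso hX) hS.zero_mem

lemma IsTriangulatedSub.shift_mem (hS : IsTriangulatedSub S) {X : E} (hX : X ∈ S) :
    X⟦(1 : ℤ)⟧ ∈ S :=
  hS.two_of_three₃ _ (contractible_distinguished₂ X) hX hS.zero_mem

lemma IsTriangulatedSub.mem_of_shift_mem (hS : IsTriangulatedSub S) {X : E}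
    (hX : X⟦(1 : ℤ)⟧ ∈ S) : X ∈ S :=
  hS.two_of_three₁ _ (contractible_distinguished₂ X) hS.zero_mem hX

/-- The morphism `f` has a cone in `S`. -/
def HasConeIn (S : Set E) {X Y : E} (f : X ⟶ Y) : Prop :=
  ∃ (Z : E) (g : Y ⟶ Z) (h : Z ⟶ X⟦(1 : ℤ)⟧), Triangle.mk f g h ∈ distTriang E ∧ Z ∈ S

lemma IsTriangulatedSub.hasConeIn_of_isIso (hS : IsTriangulatedSub S) {X Y : E} (f : X ⟶ Y)
    [IsIso f] : HasConeIn S f := by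
  obtain ⟨Z, g, h, hT⟩ := distinguished_cocone_triangle f
  exact ⟨Z, g, h, hT, hS.mem_of_isZero (Triangle.isZero₃_of_isIso₁ _ hT ‹_›)⟩

lemma IsTriangulatedSub.hasConeIn_mor₂ (hS : IsTriangulatedSub S) {T : Triangle E}
    (hT : T ∈ distTriang E) (h₁ : T.obj₁ ∈ S) : HasConeIn S T.mor₂ :=
  ⟨_, _, _, rot_of_distTriang T hT, hS.shift_mem h₁⟩

lemma IsTriangulatedSub.hasConeIn_comp [IsTriangulated E] (hS : IsTriangulatedSub S)
    {X Y Z : E} {f : X ⟶ Y} {g : Y ⟶ Z} (hf : HasConeIn S f) (hg : HasConeIn S g) :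
    HasConeIn S (f ≫ g) := by
  obtain ⟨P, f₂, f₃, hf, hP⟩ := hf
  obtain ⟨Q, g₂, g₃, hg, hQ⟩ := hg
  obtain ⟨R, r₂, r₃, hr⟩ := distinguished_cocone_triangle (f ≫ g)
  exact ⟨R, r₂, r₃, hr, hS.two_of_three₂ _ (Triangulated.someOctahedron rfl hf hg hr).mem hP hQ⟩

lemma IsThick.mem_of_hasConeIn_zero (hS : IsThick S) {X Y : E}
    (h : HasConeIn S (0 : X ⟶ Y)) : X ∈ S := by
  obtain ⟨Z, g, h, hT, hZ⟩ := h
  obtain ⟨i, hi⟩ := Triangle.coyoneda_exact₁ _ hT (𝟙 (X⟦(1 : ℤ)⟧))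
    ((congrArg (𝟙 _ ≫ ·) (Functor.map_zero _ _ _)).trans comp_zero)
  exact hS.1.mem_of_shift_mem (hS.2 ⟨i, h, hi.symm⟩ hZ)

lemma IsCompactObj.of_distTriang [HasCoproducts.{v} E] {T : Triangle E}
    (hT : T ∈ distTriang E) (h₁ : IsCompactObj T.obj₁) (h₃ : IsCompactObj T.obj₃) :
    IsCompactObj T.obj₂ := by
  classical
  rw [isCompactObj_iff] at h₁ h₃ ⊢
  intro ι x f
  obtain ⟨s, hs⟩ := h₁ x (T.mor₁ ≫ f)
  obtain ⟨g, hg⟩ := Triangle.yoneda_exact₂ _ hT (f ≫ (𝟙 _ - finsetProj x s)) (by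
    rw [← assoc, Preadditive.comp_sub, comp_id, hs, sub_self])
  obtain ⟨s', hs'⟩ := h₃ x g
  refine ⟨s ∪ s', ?_⟩
  have h : f ≫ (𝟙 _ - finsetProj x (s ∪ s')) = 0 := by
    rw [← id_sub_finsetProj_comp, ← assoc, hg, assoc, Preadditive.comp_sub, comp_id, hs',
      sub_self, comp_zero]
  rw [Preadditive.comp_sub, comp_id, sub_eq_zero] at h
  exact h.symm

lemma IsCompactObj.shift [HasCoproducts.{v} E] {X : E} (hX : IsCompactObj X) (n : ℤ) :
    IsCompactObj (X⟦n⟧) := by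
  have : (shiftEquiv E n).inverse.Additive :=
    inferInstanceAs (shiftFunctor E (-n)).Additive
  change IsCompactObj ((shiftEquiv E n).functor.obj X)
  exact hX.map_leftAdjoint (shiftEquiv E n).toAdjunction

end TriangulatedSub

section Monoidal

variable {E : Type*} [Category.{v} E] [MonoidalCategory E]

/-- The tensor powers of `c`. -/
def tensorTower (c : E) : ℕ → E
  | 0 => 𝟙_ E
  | n + 1 => c ⊗ tensorTower c n

/-- The transition maps between tensor powers induced by `ξ : 𝟙_ E ⟶ c`. -/
def tensorTowerMap {c : E} (ξ : 𝟙_ E ⟶ c) (n : ℕ) :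
    tensorTower c n ⟶ tensorTower c (n + 1) :=
  (λ_ (tensorTower c n)).inv ≫ ξ ▷ tensorTower c n

variable [Preadditive E]

lemma isZero_tensor_of_retract {X Y Z : E} (i : Y ⟶ X) (r : X ⟶ Y) (hir : i ≫ r = 𝟙 Y)
    (h : IsZero (X ⊗ Z)) : IsZero (Y ⊗ Z) := by
  rw [IsZero.iff_id_eq_zero, ← id_whiskerRight, ← hir, comp_whiskerRight, h.eq_of_tgt (i ▷ Z) 0,
    zero_comp]

lemma whiskerLeft_eq_zero_of_evaluation_comp_eq_zero {a e c : E} [ExactPairing a e]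
    [(tensorLeft a).Additive] {ξ : 𝟙_ E ⟶ c} (h : ε_ a e ≫ ξ = 0) : a ◁ ξ = 0 := by
  rw [← cancel_epi ((λ_ a).hom ≫ (ρ_ a).inv), ← ExactPairing.evaluation_coevaluation a e]
  simp only [assoc, ← MonoidalCategory.whiskerLeft_comp, h]
  rw [show a ◁ (0 : e ⊗ a ⟶ c) = 0 from (tensorLeft a).map_zero _ _]
  simp

lemma whiskerLeft_tensorTowerMap {a c : E} [∀ X : E, (tensorRight X).Additive]
    {ξ : 𝟙_ E ⟶ c} (h : a ◁ ξ = 0) (n : ℕ) : a ◁ tensorTowerMap ξ n = 0 := by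
  have h' : a ◁ ξ ▷ tensorTower c n = 0 := by
    rw [← cancel_epi (α_ a (𝟙_ E) (tensorTower c n)).hom, ← associator_naturality_middle, h]
    rw [show (0 : a ⊗ 𝟙_ E ⟶ a ⊗ c) ▷ tensorTower c n = 0 from
      (tensorRight (tensorTower c n)).map_zero _ _]
    simp
  have h'' : a ◁ ((λ_ (tensorTower c n)).inv ≫ ξ ▷ tensorTower c n) = 0 := by
    rw [MonoidalCategory.whiskerLeft_comp, h', comp_zero]
  exact h''

variable [HasCoproducts.{v} E]

/-- The compact objects `y` for which some `a ∈ A` satisfies: `y` kills `F x` as soon as `a`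
kills `x`. -/
def supportedOnImage {E' : Type*} [Category.{v} E'] [MonoidalCategory E'] (F : E' ⥤ E)
    (A : Set E') : Set E :=
  {y | IsCompactObj y ∧ ∃ a ∈ A, ∀ x : E', IsZero (a ⊗ x) → IsZero (y ⊗ F.obj x)}

lemma IsCompactObj.tensor_of_exactPairing {t d d' : E} [ExactPairing d d']
    [(tensorRight d').Additive]
    [∀ ι : Type v, PreservesColimitsOfShape (Discrete ι) (tensorRight d')]
    (ht : IsCompactObj t) : IsCompactObj (t ⊗ d) :=
  ht.map_leftAdjoint (tensorRightAdjunction d d')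

lemma IsCompactObj.tensor {s t : E}
    [∀ X : E, (tensorRight X).Additive]
    [∀ (X : E) (ι : Type v), PreservesColimitsOfShape (Discrete ι) (tensorRight X)]
    (hs : IsCompactObj s) (ht : IsRigid t) :
    IsCompactObj (s ⊗ t) := by
  obtain ⟨e, ⟨_⟩⟩ := ht
  exact hs.tensor_of_exactPairing (d' := e)

variable [HasZeroObject E] [HasShift E ℤ]
  [∀ n : ℤ, (shiftFunctor E n).Additive] [Pretriangulated E] [SymmetricCategory E]

lemma IsThickTensorIdealOfCompacts.tensor_mem {A : Set E}
    (hA : IsThickTensorIdealOfCompacts E A) {s t : E} (ht : IsCompactObj t) (hs : s ∈ A) :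
    t ⊗ s ∈ A :=
  hA.2.1.1.iso_closed (β_ s t) (hA.2.2 s hs t ht)

variable [∀ X : E, (tensorRight X).CommShift ℤ]
  [∀ X : E, (tensorRight X).IsTriangulated]

lemma IsThickTensorIdealOfCompacts.tensorTower_tensor_mem {A : Set E}
    (hA : IsThickTensorIdealOfCompacts E A) {T : Triangle E} (hT : T ∈ distTriang E)
    (h₁ : IsCompactObj T.obj₁) (h₂ : T.obj₂ = 𝟙_ E) (n : ℕ) :
    ∀ y ∈ A, tensorTower T.obj₃ n ⊗ y ∈ A := by
  induction n with
  | zero => exact fun y hy => hA.2.1.1.iso_closed (λ_ y).symm hy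
  | succ n ih =>
    intro y hy
    have h : T.obj₃ ⊗ (tensorTower T.obj₃ n ⊗ y) ∈ A := by
      refine hA.2.1.1.two_of_three₃ _
        ((tensorRight (tensorTower T.obj₃ n ⊗ y)).map_distinguished T hT)
        (hA.tensor_mem h₁ (ih y hy)) ?_
      change T.obj₂ ⊗ (tensorTower T.obj₃ n ⊗ y) ∈ A
      rw [h₂]
      exact hA.2.1.1.iso_closed (λ_ _).symm (ih y hy)
    exact hA.2.1.1.iso_closed (α_ _ _ _).symm h

variable [∀ X : E, (tensorLeft X).CommShift ℤ]
  [∀ X : E, (tensorLeft X).IsTriangulated]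
  [∀ (X : E) (ι : Type v), PreservesColimitsOfShape (Discrete ι) (tensorLeft X)]
  [∀ (X : E) (ι : Type v), PreservesColimitsOfShape (Discrete ι) (tensorRight X)]

/-- If every object killed by `a` is killed by the compact object `t`, and a map `ξ` from the
unit is killed by `a`, then some tensor power of `ξ` is killed by `t`. -/
lemma exists_whiskerLeft_telescopeMap_eq_zero {a t c : E} (ht : IsCompactObj t)
    (hat : ∀ x : E, IsZero (a ⊗ x) → IsZero (t ⊗ x)) {ξ : 𝟙_ E ⟶ c} (h : a ◁ ξ = 0) :
    ∃ n, t ◁ telescopeMap (tensorTower c) (tensorTowerMap ξ) n = 0 := by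
  obtain ⟨f, g, k, hT⟩ := distinguished_cocone_triangle
    (𝟙 _ - telescopeShift (tensorTower c) (tensorTowerMap ξ))
  have hf : IsZero (a ⊗ f) := by
    have : IsIso ((tensorLeft a).map
        (𝟙 _ - telescopeShift (tensorTower c) (tensorTowerMap ξ))) := by
      rw [map_id_sub_telescopeShift _ _ (tensorLeft a) (whiskerLeft_tensorTowerMap h)]
      infer_instance
    exact Triangle.isZero₃_of_isIso₁ _ ((tensorLeft a).map_distinguished _ hT) this
  have hiso : IsIso ((tensorLeft t).map
      (𝟙 _ - telescopeShift (tensorTower c) (tensorTowerMap ξ))) :=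
    (Triangle.isZero₃_iff_isIso₁ _ ((tensorLeft t).map_distinguished _ hT)).1 (hat f hf)
  obtain ⟨n, hn⟩ := exists_comp_map_telescopeMap_eq_zero _ _ (tensorLeft t) ht hiso (ρ_ t).inv
  refine ⟨n, ?_⟩
  exact (cancel_epi (ρ_ t).inv).1 (hn.trans comp_zero.symm)

/-- A compact object killing everything that is killed by some `a ∈ A` lies in `A`. -/
lemma IsThickTensorIdealOfCompacts.mem_of_forall_isZero [IsTriangulated E] {A : Set E}
    (hA : IsThickTensorIdealOfCompacts E A) {a t : E} (ha : a ∈ A) (hra : IsRigid a)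
    (ht : IsCompactObj t) (hat : ∀ x : E, IsZero (a ⊗ x) → IsZero (t ⊗ x)) : t ∈ A := by
  obtain ⟨e, ⟨_⟩⟩ := hra
  let : ExactPairing e a := BraidedCategory.exactPairing_swap a e
  have hS := hA.2.1.1
  have hea : IsCompactObj (e ⊗ a) :=
    IsCompactObj.of_iso (IsCompactObj.tensor_of_exactPairing (d' := a) (hA.1 ha)) (β_ a e)
  obtain ⟨c, ξ, δ, hT⟩ := distinguished_cocone_triangle (ε_ a e)
  obtain ⟨n, hn⟩ := exists_whiskerLeft_telescopeMap_eq_zero ht hat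
    (whiskerLeft_eq_zero_of_evaluation_comp_eq_zero (comp_distTriang_mor_zero₁₂ _ hT))
  have htea : t ⊗ (e ⊗ a) ∈ A :=
    hS.iso_closed (α_ t e a) (hA.tensor_mem (ht.tensor_of_exactPairing (d' := a)) ha)
  have hstep : ∀ n, HasConeIn A (t ◁ tensorTowerMap ξ n) := by
    intro n
    have h : HasConeIn A (t ◁ ξ ▷ tensorTower c n) :=
      hS.hasConeIn_mor₂ ((tensorLeft t).map_distinguished _
        ((tensorRight (tensorTower c n)).map_distinguished _ hT))
        (hS.iso_closed ((β_ _ _).symm ≪≫ α_ _ _ _)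
          (hA.tensorTower_tensor_mem hT hea rfl n _ htea))
    have := hS.hasConeIn_comp
      (hS.hasConeIn_of_isIso (t ◁ (λ_ (tensorTower c n)).inv)) h
    rw [← MonoidalCategory.whiskerLeft_comp] at this
    exact this
  have hcone : ∀ n, HasConeIn A (t ◁ telescopeMap (tensorTower c) (tensorTowerMap ξ) n) := by
    intro n
    induction n with
    | zero =>
      rw [telescopeMap]
      exact hS.hasConeIn_of_isIso _
    | succ n ih =>
      rw [telescopeMap, MonoidalCategory.whiskerLeft_comp]
      exact hS.hasConeIn_comp ih (hstep n)
  exact hS.iso_closed (ρ_ t) (hA.2.1.mem_of_hasConeIn_zero (hn ▸ hcone n))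

end Monoidal

lemma isThickTensorIdealOfCompacts_supportedOnImage
    (hrigD : ∀ t : D, IsCompactObj t → IsRigid t) (F : C ⥤ D) {A : Set C}
    (hA : IsThickTensorIdealOfCompacts C A) :
    IsThickTensorIdealOfCompacts D (supportedOnImage F A) := by
  refine ⟨fun y hy => hy.1, ⟨.of_shift_of_ext ?_ ?_ ?_ ?_, ?_⟩, ?_⟩
  · exact ⟨isCompactObj_of_isZero (isZero_zero D), 0, hA.2.1.1.zero_mem,
      fun x _ => (tensorRight (F.obj x)).map_isZero (isZero_zero D)⟩
  · rintro X Y e ⟨hX, a, ha, h⟩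
    exact ⟨hX.of_iso e, a, ha,
      fun x hx => (h x hx).of_iso ((tensorRight (F.obj x)).mapIso e.symm)⟩
  · rintro X n ⟨hX, a, ha, h⟩
    exact ⟨hX.shift n, a, ha, fun x hx => ((shiftFunctor D n).map_isZero (h x hx)).of_iso
      (((tensorRight (F.obj x)).commShiftIso n).app X)⟩
  · rintro T hT ⟨h₁, a, ha, hza⟩ ⟨h₃, b, hb, hzb⟩
    refine ⟨IsCompactObj.of_distTriang hT h₁ h₃, a ⊞ b,
      hA.2.1.1.two_of_three₂ _ (binaryBiproductTriangle_distinguished a b) ha hb,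
      fun x hx => Triangle.isZero₂_of_isZero₁₃ _
        ((tensorRight (F.obj x)).map_distinguished T hT) (hza x ?_) (hzb x ?_)⟩
    · exact isZero_tensor_of_retract biprod.inl biprod.fst biprod.inl_fst hx
    · exact isZero_tensor_of_retract biprod.inr biprod.snd biprod.inr_snd hx
  · rintro X Y ⟨i, r, hir⟩ ⟨hX, a, ha, h⟩
    exact ⟨hX.of_retract i r hir, a, ha, fun x hx => isZero_tensor_of_retract i r hir (h x hx)⟩
  · rintro s ⟨hs, a, ha, h⟩ t ht
    refine ⟨hs.tensor (hrigD t ht), a, ha, fun x hx => ?_⟩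
    exact ((tensorLeft t).map_isZero (h x hx)).of_iso
      ((β_ s t ⊗ᵢ Iso.refl _) ≪≫ α_ t s (F.obj x))

lemma subset_of_thickTensorIdealGenOfCompacts_subset
    (hrigC : ∀ t : C, IsCompactObj t → IsRigid t)
    (hrigD : ∀ t : D, IsCompactObj t → IsRigid t)
    (F : C ⥤ D) [F.PreservesZeroMorphisms] [F.Monoidal] [F.ReflectsIsomorphisms]
    (hFc : ∀ t : C, IsCompactObj t → IsCompactObj (F.obj t))
    {A B : Set C} (hA : IsThickTensorIdealOfCompacts C A)
    (hB : IsThickTensorIdealOfCompacts C B)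
    (h : thickTensorIdealGenOfCompacts D (F.obj '' A) ⊆
      thickTensorIdealGenOfCompacts D (F.obj '' B)) :
    A ⊆ B := by
  intro t ht
  have hmem : F.obj t ∈ thickTensorIdealGenOfCompacts D (F.obj '' A) :=
    Set.mem_sInter.2 fun S hS => hS.2 (Set.mem_image_of_mem _ ht)
  have hsub : F.obj '' B ⊆ supportedOnImage F B := by
    rintro _ ⟨b, hb, rfl⟩
    exact ⟨hFc b (hB.1 hb), b, hb,
      fun x hx => (F.map_isZero hx).of_iso (Functor.Monoidal.μIso F b x)⟩
  obtain ⟨-, b, hb, hbt⟩ := Set.mem_sInter.1 (h hmem) _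
    ⟨isThickTensorIdealOfCompacts_supportedOnImage hrigD F hB, hsub⟩
  exact hB.mem_of_forall_isZero hb (hrigC b (hB.1 hb)) (hA.1 ht) fun x hx =>
    isZero_of_isZero_map F ((hbt x hx).of_iso (Functor.Monoidal.μIso F t x).symm)

/-- Let `F : T → T'` be a coproduct-preserving, conservative tensor
triangulated functor between rigidly compactly generated tensor triangulated categories with
`F(T^c) ⊆ T'^c`. Then the induced map on thick tensor ideals of compact objects is
injective. -/
theorem thick_injective_of_conservative
    (hCGC : IsCompactlyGenerated C) (hrigC : ∀ t : C, IsCompactObj t → IsRigid t)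
    (hCGD : IsCompactlyGenerated D) (hrigD : ∀ t : D, IsCompactObj t → IsRigid t)
    (F : C ⥤ D) [F.CommShift ℤ] [F.IsTriangulated] [F.Braided]
    [∀ ι : Type v, PreservesColimitsOfShape (Discrete ι) F]
    [F.ReflectsIsomorphisms]
    (hFc : ∀ t : C, IsCompactObj t → IsCompactObj (F.obj t))
    (A B : Set C) (hA : IsThickTensorIdealOfCompacts C A)
    (hB : IsThickTensorIdealOfCompacts C B)
    (h : thickTensorIdealGenOfCompacts D (F.obj '' A) =
      thickTensorIdealGenOfCompacts D (F.obj '' B)) :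
    A = B := by
  exact (subset_of_thickTensorIdealGenOfCompacts_subset hrigC hrigD F hFc hA hB h.subset).antisymm
    (subset_of_thickTensorIdealGenOfCompacts_subset hrigC hrigD F hFc hB hA h.superset)

end Paper
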